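/- (Per-iterate first-order convergence bound, Theorem 1, first case.) Let f : ℝ^d → ℝ and A : ℝ^d → ℝ^m be differentiable, and g : ℝ^d → ℝ convex. Fix β > 0, ν > 0, ε ≥ 0, σ_1 > 0, 0 ≤ σ ≤ σ_1, y ∈ ℝ^m and x ∈ ℝ^d, and constants λ'_f, λ'_A, y_max ≥ 0 with ‖∇f(x)‖ ≤ λ'_f, ‖DA(x)‖ ≤ λ'_A, ‖y‖ ≤ y_max, and ε ≤ λ'_f + λ'_A y_max. Assume (i) dist(−∇_x 𝓛_β(x, y), ∂g(x)) ≤ ε; (ii) regularity: ν ‖A(x)‖ ≤ dist(−DA(x)ᵀA(x), ∂g(x)/β). Then, with y' := y + σ A(x), dist(−∇_x 𝓛_β(x, y'), ∂g(x)) + ‖A(x)‖ ≤ (2 λ'_A σ_1 + 2)(λ'_f + λ'_A y_max) / (ν β) + ε. -/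

import Mathlib

open scoped RealInnerProductSpace

/-- The subdifferential of a convex function `g` at `x`. -/
def subdiff {d : ℕ} (g : EuclideanSpace ℝ (Fin d) → ℝ) (x : EuclideanSpace ℝ (Fin d)) :
    Set (EuclideanSpace ℝ (Fin d)) :=
  {v | ∀ z, g x + ⟪v, z - x⟫ ≤ g z}

/-- The gradient of the augmented Lagrangian in its primal variable. -/
theorem hasGradientAt_augmentedLagrangian {E F : Type*}
    [NormedAddCommGroup E] [InnerProductSpace ℝ E] [CompleteSpace E]
    [NormedAddCommGroup F] [InnerProductSpace ℝ F] [CompleteSpace F]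
    {f : E → ℝ} {A : E → F} {x : E}
    (hf : DifferentiableAt ℝ f x) (hA : DifferentiableAt ℝ A x) (β : ℝ) (y : F) :
    HasGradientAt (fun z => f z + ⟪A z, y⟫ + β / 2 * ‖A z‖ ^ 2)
      (gradient f x + ContinuousLinearMap.adjoint (fderiv ℝ A x) y
        + β • ContinuousLinearMap.adjoint (fderiv ℝ A x) (A x)) x := by
  rw [hasGradientAt_iff_hasFDerivAt]
  have hf' := hf.hasGradientAt.hasFDerivAt
  have hA' := hA.hasFDerivAt
  refine ((hf'.add (hA'.inner ℝ (hasFDerivAt_const y x))).add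
    (hA'.norm_sq.const_mul (β / 2))).congr_fderiv ?_
  ext v
  simp [ContinuousLinearMap.adjoint_inner_left, real_inner_comm]
  ring

/-- The distance to a set scales with a positive homothety. -/
theorem infDist_image_inv_smul {E : Type*} [NormedAddCommGroup E] [NormedSpace ℝ E]
    {β : ℝ} (hβ : 0 < β) (u : E) (S : Set E) :
    Metric.infDist u ((fun z => β⁻¹ • z) '' S) = β⁻¹ * Metric.infDist (β • u) S := by
  have h := infDist_smul₀ (inv_ne_zero hβ.ne') S (β • u)
  rw [inv_smul_smul₀ hβ.ne', Real.norm_of_nonneg (inv_nonneg.2 hβ.le)] at h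
  exact h

/-- Per-iterate first-order convergence bound; Theorem 1, first case.
Under near-stationarity of `x` for `𝓛_β(·,y) + g` and the regularity condition,
with `y' = y + σ A(x)` and `σ ≤ σ₁`,
`dist(−∇_x 𝓛_β(x,y'), ∂g(x)) + ‖A(x)‖ ≤ (2λ'_A σ₁ + 2)(λ'_f + λ'_A y_max)/(νβ) + ε`. -/
theorem stmt_8 {d m : ℕ} (f : EuclideanSpace ℝ (Fin d) → ℝ)
    (A : EuclideanSpace ℝ (Fin d) → EuclideanSpace ℝ (Fin m))
    (g : EuclideanSpace ℝ (Fin d) → ℝ)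
    (hf : Differentiable ℝ f) (hA : Differentiable ℝ A)
    (hg : ConvexOn ℝ Set.univ g)
    (β ν ε σ₁ σ lf' lA' ymax : ℝ)
    (hβ : 0 < β) (hν : 0 < ν) (hε : 0 ≤ ε) (hσ₁ : 0 < σ₁) (hσ : 0 ≤ σ) (hσσ₁ : σ ≤ σ₁)
    (hlf' : 0 ≤ lf') (hlA' : 0 ≤ lA') (hymax : 0 ≤ ymax)
    (y : EuclideanSpace ℝ (Fin m)) (x : EuclideanSpace ℝ (Fin d))
    (hgf : ‖gradient f x‖ ≤ lf') (hDA : ‖fderiv ℝ A x‖ ≤ lA') (hy : ‖y‖ ≤ ymax)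
    (hεb : ε ≤ lf' + lA' * ymax)
    (h1 : Metric.infDist
      (-gradient (fun z => f z + ⟪A z, y⟫ + β / 2 * ‖A z‖ ^ 2) x)
      (subdiff g x) ≤ ε)
    (h2 : ν * ‖A x‖ ≤ Metric.infDist
      (-(ContinuousLinearMap.adjoint (fderiv ℝ A x) (A x)))
      ((fun z => β⁻¹ • z) '' subdiff g x)) :
    Metric.infDist
        (-gradient (fun z => f z + ⟪A z, y + σ • A x⟫ + β / 2 * ‖A z‖ ^ 2) x)
        (subdiff g x) + ‖A x‖
      ≤ (2 * lA' * σ₁ + 2) * (lf' + lA' * ymax) / (ν * β) + ε := by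
  have hC : 0 ≤ lf' + lA' * ymax := by positivity
  have hJ : ‖ContinuousLinearMap.adjoint (fderiv ℝ A x)‖ ≤ lA' := by
    rwa [LinearIsometryEquiv.norm_map]
  rw [(hasGradientAt_augmentedLagrangian (hf x) (hA x) β _).gradient] at h1 ⊢
  rw [infDist_image_inv_smul hβ] at h2
  set J := ContinuousLinearMap.adjoint (fderiv ℝ A x)
  have hgrad : ‖gradient f x + J y‖ ≤ lf' + lA' * ymax :=
    norm_add_le_of_le hgf (J.le_of_opNorm_le_of_le hJ hy)
  have hfeas : β * (ν * ‖A x‖) ≤ 2 * (lf' + lA' * ymax) := by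
    have h3 := Metric.infDist_le_infDist_add_dist (s := subdiff g x)
      (x := β • -J (A x)) (y := -(gradient f x + J y + β • J (A x)))
    have h4 : dist (β • -J (A x)) (-(gradient f x + J y + β • J (A x)))
        = ‖gradient f x + J y‖ := by
      rw [dist_eq_norm]; congr 1; module
    have h5 := (le_inv_mul_iff₀ hβ).1 h2
    linarith
  have hA_le : ‖A x‖ ≤ 2 * (lf' + lA' * ymax) / (ν * β) := by
    rw [le_div_iff₀ (by positivity)]
    linarith
  have h6 := Metric.infDist_le_infDist_add_dist (s := subdiff g x)
    (x := -(gradient f x + J (y + σ • A x) + β • J (A x)))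
    (y := -(gradient f x + J y + β • J (A x)))
  have h7 : dist (-(gradient f x + J (y + σ • A x) + β • J (A x)))
      (-(gradient f x + J y + β • J (A x))) ≤ σ₁ * (lA' * ‖A x‖) := by
    have h8 : -(gradient f x + J (y + σ • A x) + β • J (A x))
        - -(gradient f x + J y + β • J (A x)) = -(σ • J (A x)) := by
      rw [map_add, map_smul]; module
    rw [dist_eq_norm, h8, norm_neg, norm_smul, Real.norm_of_nonneg hσ]
    exact mul_le_mul hσσ₁ (J.le_of_opNorm_le hJ _) (norm_nonneg _) hσ₁.le
  calc
    _ ≤ (lA' * σ₁ + 1) * ‖A x‖ + ε := by linarith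
    _ ≤ (lA' * σ₁ + 1) * (2 * (lf' + lA' * ymax) / (ν * β)) + ε := by gcongr
    _ = _ := by ring
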